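/- For a centered bivariate Gaussian (B,G) with unit variances and correlation ρ ∈ (−1,1), E[φ(B)·φ(G)] = (1/(2π))·arctan(ρ/√(4−ρ²)), where φ(s) = Φ(s) − 1/2. -/

import Mathlib

open MeasureTheory ProbabilityTheory

noncomputable def gauss (s : ℝ) : ℝ := (Real.sqrt (2 * Real.pi))⁻¹ * Real.exp (-s ^ 2 / 2)

noncomputable def PhiCDF (a : ℝ) : ℝ := ∫ t in Set.Iic a, gauss t

noncomputable def phiTr (s : ℝ) : ℝ := PhiCDF s - 1 / 2

lemma gauss_eq_gaussianPDFReal : gauss = gaussianPDFReal 0 1 := by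
  ext x
  simp [gauss, gaussianPDFReal]

lemma continuous_gauss : Continuous gauss := by
  unfold gauss
  fun_prop

lemma integrable_gauss : Integrable gauss :=
  gauss_eq_gaussianPDFReal ▸ integrable_gaussianPDFReal 0 1

lemma gauss_nonneg (x : ℝ) : 0 ≤ gauss x := by
  unfold gauss
  positivity

lemma gauss_le_one (x : ℝ) : gauss x ≤ 1 := by
  have h1 : (√(2 * Real.pi))⁻¹ ≤ 1 := by
    apply inv_le_one_of_one_le₀
    rw [Real.one_le_sqrt]
    linarith [Real.pi_gt_three]
  have h2 : Real.exp (-x ^ 2 / 2) ≤ 1 := by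
    rw [Real.exp_le_one_iff]
    nlinarith [sq_nonneg x]
  exact mul_le_one₀ h1 (Real.exp_nonneg _) h2

lemma hasDerivAt_gauss (x : ℝ) : HasDerivAt gauss (-x * gauss x) x := by
  have h := ((((hasDerivAt_id x).pow 2).neg.div_const 2).exp).const_mul (√(2 * Real.pi))⁻¹
  refine h.congr_deriv ?_
  simp [gauss]
  ring

lemma hasDerivAt_PhiCDF (x : ℝ) : HasDerivAt PhiCDF (gauss x) x := by
  have h : PhiCDF = fun y => PhiCDF 0 + ∫ t in (0 : ℝ)..y, gauss t := by
    ext y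
    rw [PhiCDF, PhiCDF, ← intervalIntegral.integral_Iic_sub_Iic integrable_gauss.integrableOn
      integrable_gauss.integrableOn]
    ring
  rw [h]
  exact (continuous_gauss.integral_hasStrictDerivAt 0 x).hasDerivAt.const_add _

lemma hasDerivAt_phiTr (x : ℝ) : HasDerivAt phiTr (gauss x) x :=
  (hasDerivAt_PhiCDF x).sub_const _

lemma continuous_PhiCDF : Continuous PhiCDF :=
  continuous_iff_continuousAt.2 fun x => (hasDerivAt_PhiCDF x).continuousAt

lemma continuous_phiTr : Continuous phiTr :=
  continuous_PhiCDF.sub continuous_const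

lemma PhiCDF_eq_measureReal (x : ℝ) : PhiCDF x = (gaussianReal 0 1).real (Set.Iic x) := by
  rw [Measure.real, gaussianReal_apply_eq_integral 0 one_ne_zero, ← gauss_eq_gaussianPDFReal,
    ENNReal.toReal_ofReal (integral_nonneg gauss_nonneg)]
  rfl

lemma abs_PhiCDF_le_one (x : ℝ) : |PhiCDF x| ≤ 1 := by
  rw [PhiCDF_eq_measureReal, abs_of_nonneg measureReal_nonneg]
  exact measureReal_le_one

lemma abs_phiTr_le_one (x : ℝ) : |phiTr x| ≤ 1 := by
  have h0 : 0 ≤ PhiCDF x := by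
    rw [PhiCDF_eq_measureReal]
    exact measureReal_nonneg
  have h1 := (abs_le.1 (abs_PhiCDF_le_one x)).2
  rw [phiTr, abs_le]
  constructor <;> linarith

lemma phiTr_zero : phiTr 0 = 0 := by
  have h : PhiCDF 0 = ∫ t in Set.Ioi (0 : ℝ), gauss t := by
    rw [PhiCDF, ← neg_zero, ← integral_comp_neg_Iic, neg_zero]
    simp [gauss]
  have h2 : PhiCDF 0 + ∫ t in Set.Ioi (0 : ℝ), gauss t = 1 := by
    rw [PhiCDF, intervalIntegral.integral_Iic_add_Ioi integrable_gauss.integrableOn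
      integrable_gauss.integrableOn, gauss_eq_gaussianPDFReal]
    exact integral_gaussianPDFReal_eq_one 0 one_ne_zero
  rw [phiTr]
  linarith

lemma integral_gaussianReal_eq_integral_mul_gauss (f : ℝ → ℝ) :
    ∫ x, f x ∂(gaussianReal 0 1) = ∫ x, f x * gauss x := by
  rw [integral_gaussianReal_eq_integral_smul one_ne_zero, ← gauss_eq_gaussianPDFReal]
  simp [mul_comm]

lemma gaussianReal_prod_map_linear (a b : ℝ) :
    ((gaussianReal 0 1).prod (gaussianReal 0 1)).map (fun p => a * p.1 + b * p.2) =
      gaussianReal 0 (Real.toNNReal (a ^ 2 + b ^ 2)) := by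
  have hind : IndepFun (fun p : ℝ × ℝ => a * p.1) (fun p : ℝ × ℝ => b * p.2)
      ((gaussianReal 0 1).prod (gaussianReal 0 1)) :=
    indepFun_prod (by fun_prop) (by fun_prop)
  have hX : ((gaussianReal 0 1).prod (gaussianReal 0 1)).map (fun p : ℝ × ℝ => a * p.1) =
      gaussianReal 0 (Real.toNNReal (a ^ 2)) := by
    have h := Measure.map_map (μ := (gaussianReal 0 1).prod (gaussianReal 0 1))
      (g := fun x : ℝ => a * x) (f := Prod.fst) (by fun_prop) (by fun_prop)
    rw [← Measure.fst, Measure.fst_prod, gaussianReal_map_const_mul] at h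
    rw [show (fun p : ℝ × ℝ => a * p.1) = (fun x : ℝ => a * x) ∘ Prod.fst from rfl, ← h,
      Real.toNNReal_of_nonneg (sq_nonneg a)]
    simp
  have hY : ((gaussianReal 0 1).prod (gaussianReal 0 1)).map (fun p : ℝ × ℝ => b * p.2) =
      gaussianReal 0 (Real.toNNReal (b ^ 2)) := by
    have h := Measure.map_map (μ := (gaussianReal 0 1).prod (gaussianReal 0 1))
      (g := fun x : ℝ => b * x) (f := Prod.snd) (by fun_prop) (by fun_prop)
    rw [← Measure.snd, Measure.snd_prod, gaussianReal_map_const_mul] at h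
    rw [show (fun p : ℝ × ℝ => b * p.2) = (fun x : ℝ => b * x) ∘ Prod.snd from rfl, ← h,
      Real.toNNReal_of_nonneg (sq_nonneg b)]
    simp
  have h := gaussianReal_add_gaussianReal_of_indepFun hind hX hY
  rw [← Real.toNNReal_add (sq_nonneg a) (sq_nonneg b), add_zero] at h
  exact h

lemma integral_PhiCDF_add_mul (x σ : ℝ) :
    ∫ z, PhiCDF (x + σ * z) ∂(gaussianReal 0 1) = PhiCDF (x / √(1 + σ ^ 2)) := by
  have hs : 0 < √(1 + σ ^ 2) := by positivity
  have hscale : (gaussianReal 0 1).map (fun y => √(1 + σ ^ 2) * y) =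
      ((gaussianReal 0 1).prod (gaussianReal 0 1)).map (fun p => -σ * p.1 + 1 * p.2) := by
    rw [gaussianReal_prod_map_linear, gaussianReal_map_const_mul, mul_zero]
    congr 1
    ext
    simp only [mul_one, NNReal.coe_mk]
    rw [Real.sq_sqrt (by positivity), Real.coe_toNNReal _ (by positivity)]
    ring
  have hset := congrArg (fun μ : Measure ℝ => μ (Set.Iic x)) hscale
  rw [Measure.map_apply (by fun_prop) measurableSet_Iic,
    Measure.map_apply (by fun_prop) measurableSet_Iic,
    Measure.prod_apply (measurableSet_Iic.preimage (by fun_prop))] at hset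
  have hpre : (fun y => √(1 + σ ^ 2) * y) ⁻¹' Set.Iic x = Set.Iic (x / √(1 + σ ^ 2)) := by
    ext y
    simp [le_div_iff₀ hs, mul_comm]
  have hsec (z : ℝ) : Prod.mk z ⁻¹' ((fun p : ℝ × ℝ => -σ * p.1 + 1 * p.2) ⁻¹' Set.Iic x) =
      Set.Iic (x + σ * z) := by
    ext y
    simp only [Set.mem_preimage, Set.mem_Iic]
    constructor <;> intro h <;> linarith
  simp_rw [hsec] at hset
  rw [hpre] at hset
  have hof (z : ℝ) : gaussianReal 0 1 (Set.Iic z) = ENNReal.ofReal (PhiCDF z) := by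
    rw [PhiCDF_eq_measureReal, ofReal_measureReal]
  have hnn (z : ℝ) : 0 ≤ PhiCDF z := by
    rw [PhiCDF_eq_measureReal]
    exact measureReal_nonneg
  simp_rw [hof] at hset
  rw [integral_eq_lintegral_of_nonneg_ae (ae_of_all _ fun z => hnn _), ← hset,
    ENNReal.toReal_ofReal (hnn _)]
  exact (continuous_PhiCDF.comp (by fun_prop)).aestronglyMeasurable

lemma integrable_of_continuous_of_abs_le_one {α : Type*} [TopologicalSpace α]
    [MeasurableSpace α] [OpensMeasurableSpace α] [SecondCountableTopology α] {μ : Measure α}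
    [IsFiniteMeasure μ] {f : α → ℝ} (hf : Continuous f) (hb : ∀ x, |f x| ≤ 1) :
    Integrable f μ :=
  Integrable.of_bound hf.aestronglyMeasurable 1 (ae_of_all _ hb)

lemma integral_phiTr_add_mul (x σ : ℝ) :
    ∫ z, phiTr (x + σ * z) ∂(gaussianReal 0 1) = phiTr (x / √(1 + σ ^ 2)) := by
  simp only [phiTr]
  rw [integral_sub, integral_PhiCDF_add_mul]
  · simp
  · exact integrable_of_continuous_of_abs_le_one (continuous_PhiCDF.comp (by fun_prop))
      fun _ => abs_PhiCDF_le_one _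
  · exact integrable_const _

lemma abs_phiTr_mul_phiTr_le_one (x y : ℝ) : |phiTr x * phiTr y| ≤ 1 := by
  rw [abs_mul]
  exact mul_le_one₀ (abs_phiTr_le_one x) (abs_nonneg _) (abs_phiTr_le_one y)

lemma gauss_mul_gauss_mul_gauss (c b : ℝ) :
    gauss b * (gauss (c * b) * gauss b) =
      (√(2 * Real.pi))⁻¹ ^ 3 * Real.exp (-((2 + c ^ 2) / 2) * b ^ 2) := by
  rw [show -((2 + c ^ 2) / 2) * b ^ 2 = -b ^ 2 / 2 + (-(c * b) ^ 2 / 2 + -b ^ 2 / 2) by ring,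
    Real.exp_add, Real.exp_add]
  simp only [gauss]
  ring

lemma integral_gauss_mul_gauss_mul_gauss (c : ℝ) :
    ∫ b, gauss b * (gauss (c * b) * gauss b) = 1 / (2 * Real.pi * √(2 + c ^ 2)) := by
  simp_rw [gauss_mul_gauss_mul_gauss]
  rw [integral_const_mul, integral_gaussian,
    show Real.pi / ((2 + c ^ 2) / 2) = 2 * Real.pi / (2 + c ^ 2) by field_simp,
    Real.sqrt_div (by positivity)]
  have h2 : √(2 * Real.pi) ^ 2 = 2 * Real.pi := Real.sq_sqrt (by positivity)
  have h3 : √(2 * Real.pi) ≠ 0 := by positivity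
  have h4 : √(2 + c ^ 2) ≠ 0 := by positivity
  field_simp
  rw [h2]

lemma integral_phiTr_mul_id_mul_gauss (c : ℝ) :
    ∫ b, phiTr b * (b * gauss (c * b)) ∂(gaussianReal 0 1) =
      1 / (2 * Real.pi * (1 + c ^ 2) * √(2 + c ^ 2)) := by
  have hc : (1 + c ^ 2) ≠ 0 := by positivity
  have hv (b : ℝ) : HasDerivAt (fun b => -(1 + c ^ 2)⁻¹ * (gauss (c * b) * gauss b))
      (b * gauss (c * b) * gauss b) b := by
    have h1 : HasDerivAt (fun b => gauss (c * b)) (-(c * b) * gauss (c * b) * c) b := by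
      refine ((hasDerivAt_gauss (c * b)).comp b ((hasDerivAt_id b).const_mul c)).congr_deriv ?_
      ring
    refine ((h1.mul (hasDerivAt_gauss b)).const_mul (-(1 + c ^ 2)⁻¹)).congr_deriv ?_
    field_simp
    ring
  have hgg : Integrable fun b => gauss (c * b) * gauss b := by
    refine integrable_gauss.bdd_mul (c := 1)
      (continuous_gauss.comp (by fun_prop)).aestronglyMeasurable (ae_of_all _ fun b => ?_)
    rw [Real.norm_eq_abs, abs_of_nonneg (gauss_nonneg _)]
    exact gauss_le_one _
  have hbg : Integrable fun b => b * gauss (c * b) * gauss b := by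
    have h : Integrable fun b => (√(2 * Real.pi))⁻¹ ^ 2 *
        (b * Real.exp (-((1 + c ^ 2) / 2) * b ^ 2)) :=
      (integrable_mul_exp_neg_mul_sq (by positivity)).const_mul _
    refine h.congr (ae_of_all _ fun b => ?_)
    simp only [gauss]
    rw [show -((1 + c ^ 2) / 2) * b ^ 2 = -(c * b) ^ 2 / 2 + -b ^ 2 / 2 by ring, Real.exp_add]
    ring
  have hparts := integral_mul_deriv_eq_deriv_mul_of_integrable
    (fun b _ => hasDerivAt_phiTr b) (fun b _ => hv b)
    (hbg.bdd_mul (c := 1) continuous_phiTr.aestronglyMeasurable (ae_of_all _ abs_phiTr_le_one))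
    ((hgg.const_mul _).bdd_mul (c := 1) continuous_gauss.aestronglyMeasurable
      (ae_of_all _ fun b => by
        rw [Real.norm_eq_abs, abs_of_nonneg (gauss_nonneg _)]
        exact gauss_le_one _))
    ((hgg.const_mul _).bdd_mul (c := 1) continuous_phiTr.aestronglyMeasurable
      (ae_of_all _ abs_phiTr_le_one))
  rw [integral_gaussianReal_eq_integral_mul_gauss]
  simp_rw [mul_assoc] at hparts ⊢
  rw [hparts]
  simp_rw [mul_left_comm (gauss _) (-(1 + c ^ 2)⁻¹)]
  rw [integral_const_mul, integral_gauss_mul_gauss_mul_gauss]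
  field_simp

lemma hasDerivAt_integral_phiTr_mul_phiTr (c : ℝ) :
    HasDerivAt (fun c => ∫ b, phiTr b * phiTr (c * b) ∂(gaussianReal 0 1))
      (1 / (2 * Real.pi * (1 + c ^ 2) * √(2 + c ^ 2))) c := by
  rw [← integral_phiTr_mul_id_mul_gauss]
  refine (hasDerivAt_integral_of_dominated_loc_of_deriv_le (s := Set.univ)
    (F' := fun c b => phiTr b * (b * gauss (c * b))) (bound := fun b => |b|)
    Filter.univ_mem ?_ ?_ ?_ ?_ ?_ ?_).2
  · exact Filter.Eventually.of_forall fun c =>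
      (continuous_phiTr.mul (continuous_phiTr.comp (by fun_prop))).aestronglyMeasurable
  · exact integrable_of_continuous_of_abs_le_one
      (continuous_phiTr.mul (continuous_phiTr.comp (by fun_prop)))
      fun _ => abs_phiTr_mul_phiTr_le_one _ _
  · exact (continuous_phiTr.mul
      (continuous_id.mul (continuous_gauss.comp (by fun_prop)))).aestronglyMeasurable
  · refine ae_of_all _ fun b c _ => ?_
    rw [Real.norm_eq_abs, abs_mul, abs_mul, abs_of_nonneg (gauss_nonneg _)]
    calc |phiTr b| * (|b| * gauss (c * b)) ≤ 1 * (|b| * 1) := by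
          gcongr
          · exact mul_nonneg (abs_nonneg _) (gauss_nonneg _)
          · exact abs_phiTr_le_one b
          · exact gauss_le_one _
      _ = |b| := by ring
  · exact ((memLp_id_gaussianReal 1).integrable le_rfl).abs
  · refine ae_of_all _ fun b c _ => ?_
    have h := (hasDerivAt_phiTr (c * b)).comp c ((hasDerivAt_id c).mul_const b)
    refine (h.const_mul (phiTr b)).congr_deriv ?_
    ring

lemma hasDerivAt_arctan_div_sqrt (c : ℝ) :
    HasDerivAt (fun c => 1 / (2 * Real.pi) * Real.arctan (c / √(2 + c ^ 2)))
      (1 / (2 * Real.pi * (1 + c ^ 2) * √(2 + c ^ 2))) c := by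
  have hpos : 0 < 2 + c ^ 2 := by positivity
  have h1 : HasDerivAt (fun c : ℝ => 2 + c ^ 2) (2 * c) c := by
    simpa using (hasDerivAt_pow 2 c).const_add 2
  have h2 := ((hasDerivAt_id c).div (h1.sqrt hpos.ne') (by positivity)).arctan.const_mul
    (1 / (2 * Real.pi))
  refine h2.congr_deriv ?_
  have hs : √(2 + c ^ 2) ^ 2 = 2 + c ^ 2 := Real.sq_sqrt hpos.le
  have hs0 : √(2 + c ^ 2) ≠ 0 := by positivity
  have hc : 1 + c ^ 2 ≠ 0 := by positivity
  have hd : 2 + c ^ 2 + c ^ 2 ≠ 0 := by positivity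
  simp only [Pi.div_apply, id, div_pow, hs]
  field_simp
  rw [hs]
  field_simp
  ring

lemma integral_phiTr_mul_phiTr (c : ℝ) :
    ∫ b, phiTr b * phiTr (c * b) ∂(gaussianReal 0 1) =
      1 / (2 * Real.pi) * Real.arctan (c / √(2 + c ^ 2)) := by
  have hd (x : ℝ) := (hasDerivAt_integral_phiTr_mul_phiTr x).sub (hasDerivAt_arctan_div_sqrt x)
  have h := is_const_of_deriv_eq_zero (fun x => (hd x).differentiableAt)
    (fun x => (hd x).deriv.trans (sub_self _)) c 0
  simpa [phiTr_zero, sub_eq_zero] using h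

lemma aemeasurable_of_map_eq_gaussianReal {Ω : Type*} [MeasurableSpace Ω] {P : Measure Ω}
    {X : Ω → ℝ} {m : ℝ} {v : NNReal} (h : P.map X = gaussianReal m v) : AEMeasurable X P :=
  AEMeasurable.of_map_ne_zero (by simp [NeZero.ne, h])

lemma map_prodMk_eq_of_forall_map_linear_eq {Ω : Type*} [MeasurableSpace Ω] {P : Measure Ω}
    [IsProbabilityMeasure P] {ρ : ℝ} (hρ : ρ ∈ Set.Ioo (-1 : ℝ) 1) {B G : Ω → ℝ}
    (hB : AEMeasurable B P) (hG : AEMeasurable G P)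
    (h : ∀ a b : ℝ, P.map (fun ω => a * B ω + b * G ω) =
      gaussianReal 0 (Real.toNNReal (a ^ 2 + b ^ 2 + 2 * a * b * ρ))) :
    P.map (fun ω => (B ω, G ω)) = ((gaussianReal 0 1).prod (gaussianReal 0 1)).map
      (fun p => (p.1, ρ * p.1 + √(1 - ρ ^ 2) * p.2)) := by
  have hBG : AEMeasurable (fun ω => (B ω, G ω)) P := hB.prodMk hG
  have hmeas : Measurable fun p : ℝ × ℝ => (p.1, ρ * p.1 + √(1 - ρ ^ 2) * p.2) := by fun_prop
  have : IsProbabilityMeasure (P.map fun ω => (B ω, G ω)) := Measure.isProbabilityMeasure_map hBG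
  have : IsProbabilityMeasure (((gaussianReal 0 1).prod (gaussianReal 0 1)).map
      fun p => (p.1, ρ * p.1 + √(1 - ρ ^ 2) * p.2)) :=
    Measure.isProbabilityMeasure_map hmeas.aemeasurable
  refine Measure.ext_of_charFunDual (funext fun L => ?_)
  have hL (p : ℝ × ℝ) : L p = L (1, 0) * p.1 + L (0, 1) * p.2 := by
    have hp : p = p.1 • ((1 : ℝ), (0 : ℝ)) + p.2 • ((0 : ℝ), (1 : ℝ)) := by ext <;> simp
    conv_lhs => rw [hp, map_add, map_smul, map_smul]
    simp [mul_comm]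
  rw [charFunDual_eq_charFun_map_one, charFunDual_eq_charFun_map_one,
    AEMeasurable.map_map_of_aemeasurable (by fun_prop) hBG, Measure.map_map (by fun_prop) hmeas]
  congr 1
  have h1 : L ∘ (fun ω => (B ω, G ω)) = fun ω => L (1, 0) * B ω + L (0, 1) * G ω := by
    ext ω
    simp [hL (B ω, G ω)]
  have h2 : L ∘ (fun p : ℝ × ℝ => (p.1, ρ * p.1 + √(1 - ρ ^ 2) * p.2)) =
      fun p => (L (1, 0) + L (0, 1) * ρ) * p.1 + (L (0, 1) * √(1 - ρ ^ 2)) * p.2 := by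
    ext p
    rw [Function.comp_apply, hL]
    ring
  rw [h1, h2, h, gaussianReal_prod_map_linear]
  congr 2
  rw [mul_pow, Real.sq_sqrt (by nlinarith [hρ.1, hρ.2])]
  ring

theorem stmt17 {Ω : Type*} [MeasureSpace Ω] [IsProbabilityMeasure (ℙ : Measure Ω)]
    (ρ : ℝ) (hρ : ρ ∈ Set.Ioo (-1:ℝ) 1) (B G : Ω → ℝ)
    (hGauss : ∀ a b : ℝ, Measure.map (fun ω => a * B ω + b * G ω) ℙ =
      gaussianReal 0 (Real.toNNReal (a ^ 2 + b ^ 2 + 2 * a * b * ρ))) :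
    (∫ ω, phiTr (B ω) * phiTr (G ω)) =
      (1 / (2 * Real.pi)) * Real.arctan (ρ / Real.sqrt (4 - ρ ^ 2)) := by
  have hB : AEMeasurable B (ℙ : Measure Ω) := by
    simpa using aemeasurable_of_map_eq_gaussianReal (hGauss 1 0)
  have hG : AEMeasurable G (ℙ : Measure Ω) := by
    simpa using aemeasurable_of_map_eq_gaussianReal (hGauss 0 1)
  have hρ2 : 0 < 1 - ρ ^ 2 := by nlinarith [hρ.1, hρ.2]
  have hcont : Continuous fun p : ℝ × ℝ => phiTr p.1 * phiTr p.2 :=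
    (continuous_phiTr.comp continuous_fst).mul (continuous_phiTr.comp continuous_snd)
  have hmeas : Measurable fun p : ℝ × ℝ => (p.1, ρ * p.1 + √(1 - ρ ^ 2) * p.2) := by fun_prop
  have hjoint : (∫ ω, phiTr (B ω) * phiTr (G ω)) =
      ∫ p, phiTr p.1 * phiTr (ρ * p.1 + √(1 - ρ ^ 2) * p.2)
        ∂((gaussianReal 0 1).prod (gaussianReal 0 1)) := by
    rw [← integral_map (hB.prodMk hG) (f := fun p : ℝ × ℝ => phiTr p.1 * phiTr p.2)
      hcont.aestronglyMeasurable, map_prodMk_eq_of_forall_map_linear_eq hρ hB hG hGauss,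
      integral_map hmeas.aemeasurable hcont.aestronglyMeasurable]
  rw [hjoint, integral_prod]
  · simp_rw [integral_const_mul, integral_phiTr_add_mul]
    have hc : (1 : ℝ) + √(1 - ρ ^ 2) ^ 2 = 2 - ρ ^ 2 := by
      rw [Real.sq_sqrt hρ2.le]
      ring
    have h2 : 0 < 2 - ρ ^ 2 := by linarith
    simp_rw [hc, mul_div_right_comm ρ]
    rw [integral_phiTr_mul_phiTr, div_pow, Real.sq_sqrt h2.le,
      show 2 + ρ ^ 2 / (2 - ρ ^ 2) = (4 - ρ ^ 2) / (2 - ρ ^ 2) by field_simp; ring,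
      Real.sqrt_div (by linarith), div_div_div_cancel_right₀ (by positivity)]
  · refine integrable_of_continuous_of_abs_le_one ?_ fun _ => abs_phiTr_mul_phiTr_le_one _ _
    exact (continuous_phiTr.comp continuous_fst).mul (continuous_phiTr.comp (by fun_prop))
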